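/- arXiv:2108.02994 — 3 statements merged into one kernel-verified Lean document; each statement's English description precedes it below -/
import Mathlib

section
/- (LMI sufficiency for the Variant-2 cost decrease conditions.) Let Q ∈ ℝ^{n×n} and R ∈ ℝ^{m×m} be symmetric positive definite, A ∈ ℝ^{n×n}, B ∈ ℝ^{n×m}, A₀ = [[A, B], [0, I]], and M ≥ 2. Suppose there exist symmetric positive definite matrices 𝒳₀, …, 𝒳_{M−1} ∈ ℝ^{(n+m)×(n+m)} and a matrix 𝒴 ∈ ℝ^{m×(n+m)} such that the block matrix with rows/columns of sizes (n+m), n, m, (n+m) given by [[𝒳₁, 0, 0, [[A,0],[0,0]]𝒳₀ + [[B],[I]]𝒴], [⋆, Q⁻¹, 0, [I, 0]𝒳₀], [⋆, ⋆, R⁻¹, 𝒴], [⋆, ⋆, ⋆, 𝒳₀]] is positive semidefinite, and for every j = 1, …, M−1 the block matrix [[𝒳_{(j+1) mod M}, 0, A₀𝒳_j], [⋆, diag(Q⁻¹, R⁻¹), 𝒳_j], [⋆, ⋆, 𝒳_j]] is positive semidefinite. Then the matrices P_j := 𝒳_j⁻¹ for j = 0, …, M−1 and the gain K := 𝒴𝒳₀⁻¹,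 with A₁ := [[A,0],[0,0]] + [[B],[I]]K, satisfy A₁ᵀP₁A₁ − P₀ + diag(Q, 0) + KᵀRK ⪯ 0 and A₀ᵀP_{(j+1) mod M}A₀ − P_j + diag(Q, R) ⪯ 0 for all j = 1, …, M−1. -/
open Matrix

/-- No-transmission step matrix `A₀ = [[A, B], [0, I]]`. -/
noncomputable def A0mat {n m : ℕ} (A : Matrix (Fin n) (Fin n) ℝ)
    (B : Matrix (Fin n) (Fin m) ℝ) :
    Matrix (Fin n ⊕ Fin m) (Fin n ⊕ Fin m) ℝ :=
  fromBlocks A B 0 1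

/-- Transmission step matrix `A₁ = [[A, 0], [0, 0]] + [[B], [I]] K`. -/
noncomputable def A1mat {n m : ℕ} (A : Matrix (Fin n) (Fin n) ℝ)
    (B : Matrix (Fin n) (Fin m) ℝ) (K : Matrix (Fin m) (Fin n ⊕ Fin m) ℝ) :
    Matrix (Fin n ⊕ Fin m) (Fin n ⊕ Fin m) ℝ :=
  fromBlocks A 0 0 0 + fromRows B (1 : Matrix (Fin m) (Fin m) ℝ) * K

/-- The `x`-part of a stacked vector `z = [x; u]`. -/
def xpart {n m : ℕ} (z : Fin n ⊕ Fin m → ℝ) : Fin n → ℝ := fun i => z (Sum.inl i)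

/-- The `u`-part of a stacked vector `z = [x; u]`. -/
def upart {n m : ℕ} (z : Fin n ⊕ Fin m → ℝ) : Fin m → ℝ := fun i => z (Sum.inr i)

theorem lmi1_aux {p q r : Type*} [Fintype p] [Fintype q] [Fintype r]
    [DecidableEq p] [DecidableEq q] [DecidableEq r]
    (X1 P1 X0 P0 A1 : Matrix p p ℝ) (Qi Q : Matrix q q ℝ) (Ri R : Matrix r r ℝ)
    (E : Matrix q p ℝ) (K : Matrix r p ℝ)
    (h1 : X1 * P1 = 1) (h0 : X0 * P0 = 1) (hQ : Qi * Q = 1) (hR : Ri * R = 1)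
    (hX0 : X0ᵀ = X0) (hP0 : P0ᵀ = P0)
    (h : (fromBlocks (fromBlocks X1 0 0 Qi) (fromBlocks 0 (A1 * X0) 0 (E * X0))
      (fromBlocks 0 (A1 * X0) 0 (E * X0))ᵀ
      (fromBlocks Ri (K * X0) (K * X0)ᵀ X0)).PosSemidef) :
    (-(A1ᵀ * P1 * A1 - P0 + Eᵀ * Q * E + Kᵀ * R * K)).PosSemidef := by
  have h0' : P0 * X0 = 1 := mul_eq_one_comm.mp h0
  have key := h.conjTranspose_mul_mul_same
    (fromRows (fromRows (-(P1 * A1)) (-(Q * E))) (fromRows (-(R * K)) P0))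
  have e : fromBlocks (fromBlocks X1 0 0 Qi) (fromBlocks 0 (A1 * X0) 0 (E * X0))
      (fromBlocks 0 (A1 * X0) 0 (E * X0))ᵀ
      (fromBlocks Ri (K * X0) (K * X0)ᵀ X0) *
      (fromRows (fromRows (-(P1 * A1)) (-(Q * E))) (fromRows (-(R * K)) P0))
      = fromRows (fromRows 0 0) (fromRows 0
        (X0 * (-(A1ᵀ * P1 * A1 - P0 + Eᵀ * Q * E + Kᵀ * R * K)))) := by
    have f1 : X1 * (P1 * A1) = A1 := by rw [← Matrix.mul_assoc, h1, Matrix.one_mul]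
    have f2 : Qi * (Q * E) = E := by rw [← Matrix.mul_assoc, hQ, Matrix.one_mul]
    have f3 : Ri * (R * K) = K := by rw [← Matrix.mul_assoc, hR, Matrix.one_mul]
    rw [fromBlocks_transpose, fromBlocks_mul_fromRows]
    simp only [fromBlocks_mul_fromRows, Matrix.transpose_mul, hX0, Matrix.transpose_zero,
      Matrix.zero_mul, Matrix.mul_neg, f1, f2, f3, Matrix.mul_assoc, h0, Matrix.mul_one,
      Matrix.mul_add, Matrix.mul_sub]
    ext (( i | i) | (i | i)) j <;> simp <;> ring
  have e2 : (fromRows (fromRows (-(P1 * A1)) (-(Q * E))) (fromRows (-(R * K)) P0))ᴴ *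
      fromRows (fromRows (0 : Matrix p p ℝ) (0 : Matrix q p ℝ)) (fromRows (0 : Matrix r p ℝ)
        (X0 * (-(A1ᵀ * P1 * A1 - P0 + Eᵀ * Q * E + Kᵀ * R * K))))
      = -(A1ᵀ * P1 * A1 - P0 + Eᵀ * Q * E + Kᵀ * R * K) := by
    rw [conjTranspose_eq_transpose_of_trivial]
    simp only [transpose_fromRows, fromCols_mul_fromRows, Matrix.mul_zero, hP0, zero_add]
    rw [← Matrix.mul_assoc, h0', Matrix.one_mul]
  rw [Matrix.mul_assoc, e, e2] at key
  exact key

theorem lmi2_aux {p : Type*} [Fintype p] [DecidableEq p]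
    (X1 P1 X0 P0 A1 : Matrix p p ℝ) (Qi Q : Matrix p p ℝ)
    (h1 : X1 * P1 = 1) (h0 : X0 * P0 = 1) (hQ : Qi * Q = 1)
    (hX0 : X0ᵀ = X0) (hP0 : P0ᵀ = P0)
    (h : (fromBlocks (fromBlocks X1 0 0 Qi) (fromRows (A1 * X0) X0)
      (fromRows (A1 * X0) X0)ᵀ X0).PosSemidef) :
    (-(A1ᵀ * P1 * A1 - P0 + Q)).PosSemidef := by
  have h0' : P0 * X0 = 1 := mul_eq_one_comm.mp h0
  have key := h.conjTranspose_mul_mul_same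
    (fromRows (fromRows (-(P1 * A1)) (-Q)) P0)
  have e : fromBlocks (fromBlocks X1 0 0 Qi) (fromRows (A1 * X0) X0)
      (fromRows (A1 * X0) X0)ᵀ X0 *
      (fromRows (fromRows (-(P1 * A1)) (-Q)) P0)
      = fromRows (fromRows 0 0) (X0 * (-(A1ᵀ * P1 * A1 - P0 + Q))) := by
    have f1 : X1 * (P1 * A1) = A1 := by rw [← Matrix.mul_assoc, h1, Matrix.one_mul]
    rw [transpose_fromRows, fromBlocks_mul_fromRows]
    simp only [fromBlocks_mul_fromRows, fromRows_mul, fromCols_mul_fromRows,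
      Matrix.transpose_mul, hX0,
      Matrix.zero_mul, Matrix.mul_neg, f1, hQ, Matrix.mul_assoc, h0, Matrix.mul_one,
      Matrix.mul_add, Matrix.mul_sub]
    ext (( i | i) | i) j <;> simp <;> ring
  have e2 : (fromRows (fromRows (-(P1 * A1)) (-Q)) P0)ᴴ *
      fromRows (fromRows (0 : Matrix p p ℝ) (0 : Matrix p p ℝ))
        (X0 * (-(A1ᵀ * P1 * A1 - P0 + Q)))
      = -(A1ᵀ * P1 * A1 - P0 + Q) := by
    rw [conjTranspose_eq_transpose_of_trivial]
    simp only [transpose_fromRows, fromCols_mul_fromRows, Matrix.mul_zero, hP0, zero_add]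
    rw [← Matrix.mul_assoc, h0', Matrix.one_mul]
  rw [Matrix.mul_assoc, e, e2] at key
  exact key

theorem posDef_aux {p : Type*} [Fintype p] [DecidableEq p] {X : Matrix p p ℝ} (h : X.PosDef) :
    X * X⁻¹ = 1 ∧ X⁻¹ * X = 1 ∧ Xᵀ = X ∧ X⁻¹ᵀ = X⁻¹ := by
  have hu : IsUnit X.det := (Matrix.isUnit_iff_isUnit_det _).mp h.isUnit
  have ht : Xᵀ = X := by
    have := h.isHermitian
    rwa [IsHermitian, conjTranspose_eq_transpose_of_trivial] at this
  exact ⟨mul_nonsing_inv _ hu, nonsing_inv_mul _ hu, ht, by rw [transpose_nonsing_inv, ht]⟩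

/-- LMI sufficiency for the Variant-2 cost decrease
conditions: if the two families of block LMIs in the variables
`𝒳₀, …, 𝒳_{M-1} ≻ 0` and `𝒴` are positive semidefinite, then
`P_j := 𝒳_j⁻¹` and `K := 𝒴 𝒳₀⁻¹` satisfy the Variant-2 matrix
inequalities. -/
theorem variant2_LMI_sufficiency {n m : ℕ}
    (A : Matrix (Fin n) (Fin n) ℝ) (B : Matrix (Fin n) (Fin m) ℝ)
    (M : ℕ) (hM : 2 ≤ M)
    (Q : Matrix (Fin n) (Fin n) ℝ) (R : Matrix (Fin m) (Fin m) ℝ)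
    (hQ : Q.PosDef) (hR : R.PosDef)
    (𝒳 : ℕ → Matrix (Fin n ⊕ Fin m) (Fin n ⊕ Fin m) ℝ)
    (h𝒳 : ∀ j : ℕ, j + 1 ≤ M → (𝒳 j).PosDef)
    (𝒴 : Matrix (Fin m) (Fin n ⊕ Fin m) ℝ)
    -- first LMI, block rows/columns of sizes (n+m), n, m, (n+m)
    (hLMI1 : (fromBlocks
        (fromBlocks (𝒳 1) 0 0 Q⁻¹)
        (fromBlocks 0 (fromBlocks A 0 0 0 * 𝒳 0 + fromRows B (1 : Matrix (Fin m) (Fin m) ℝ) * 𝒴)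
                    0 (fromCols (1 : Matrix (Fin n) (Fin n) ℝ) (0 : Matrix (Fin n) (Fin m) ℝ) * 𝒳 0))
        (fromBlocks 0 (fromBlocks A 0 0 0 * 𝒳 0 + fromRows B (1 : Matrix (Fin m) (Fin m) ℝ) * 𝒴)
                    0 (fromCols (1 : Matrix (Fin n) (Fin n) ℝ) (0 : Matrix (Fin n) (Fin m) ℝ) * 𝒳 0))ᵀ
        (fromBlocks R⁻¹ 𝒴 𝒴ᵀ (𝒳 0))).PosSemidef)
    -- second family of LMIs, block rows/columns of sizes (n+m), (n+m), (n+m)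
    (hLMI2 : ∀ j : ℕ, 1 ≤ j → j + 1 ≤ M →
      (fromBlocks
        (fromBlocks (𝒳 ((j + 1) % M)) 0 0 (fromBlocks Q⁻¹ 0 0 R⁻¹))
        (fromRows (A0mat A B * 𝒳 j) (𝒳 j))
        (fromRows (A0mat A B * 𝒳 j) (𝒳 j))ᵀ
        (𝒳 j)).PosSemidef) :
    -- conclusion: with `P_j := 𝒳_j⁻¹` and `K := 𝒴 𝒳₀⁻¹`,
    -- `A₁ᵀ P₁ A₁ - P₀ + diag(Q,0) + Kᵀ R K ⪯ 0`
    (-((A1mat A B (𝒴 * (𝒳 0)⁻¹))ᵀ * (𝒳 1)⁻¹ * A1mat A B (𝒴 * (𝒳 0)⁻¹)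
        - (𝒳 0)⁻¹ + fromBlocks Q 0 0 0
        + (𝒴 * (𝒳 0)⁻¹)ᵀ * R * (𝒴 * (𝒳 0)⁻¹))).PosSemidef ∧
    -- and `A₀ᵀ P_{(j+1) mod M} A₀ - P_j + diag(Q,R) ⪯ 0` for `j = 1, …, M-1`
    (∀ j : ℕ, 1 ≤ j → j + 1 ≤ M →
      (-((A0mat A B)ᵀ * (𝒳 ((j + 1) % M))⁻¹ * A0mat A B - (𝒳 j)⁻¹
          + fromBlocks Q 0 0 R)).PosSemidef) := by
  obtain ⟨a1, a2, a3, a4⟩ := posDef_aux (h𝒳 0 (by omega))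
  obtain ⟨b1, b2, b3, b4⟩ := posDef_aux (h𝒳 1 (by omega))
  obtain ⟨q1, q2, q3, q4⟩ := posDef_aux hQ
  obtain ⟨r1, r2, r3, r4⟩ := posDef_aux hR
  constructor
  · have hY : 𝒴 = (𝒴 * (𝒳 0)⁻¹) * 𝒳 0 := by rw [Matrix.mul_assoc, a2, Matrix.mul_one]
    generalize 𝒴 * (𝒳 0)⁻¹ = K at hY
    subst hY
    rw [← Matrix.mul_assoc, ← Matrix.add_mul] at hLMI1
    have := lmi1_aux (𝒳 1) _ (𝒳 0) _ (A1mat A B K) Q⁻¹ Q R⁻¹ R _ K b1 a1 q2 r2 a3 a4 hLMI1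
    have e : (fromCols (1 : Matrix (Fin n) (Fin n) ℝ) (0 : Matrix (Fin n) (Fin m) ℝ))ᵀ * Q *
        fromCols (1 : Matrix (Fin n) (Fin n) ℝ) (0 : Matrix (Fin n) (Fin m) ℝ)
        = fromBlocks Q 0 0 0 := by
      rw [transpose_fromCols, fromRows_mul, fromRows_mul_fromCols]
      simp
    rwa [e] at this
  · intro j hj1 hj2
    obtain ⟨c1, c2, c3, c4⟩ := posDef_aux (h𝒳 j hj2)
    obtain ⟨d1, d2, d3, d4⟩ := posDef_aux
      (h𝒳 ((j + 1) % M) (Nat.mod_lt _ (by omega)))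
    refine lmi2_aux _ _ _ _ _ (fromBlocks Q⁻¹ 0 0 R⁻¹) _ d1 c1 ?_ c3 c4
      (hLMI2 j hj1 hj2)
    rw [fromBlocks_multiply]
    simp [q2, r2]
end

section
/- (Infinite-horizon cost bound for the periodic time-triggered policy.) Let Q ∈ ℝ^{n×n} and R ∈ ℝ^{m×m} be symmetric positive definite, K ∈ ℝ^{m×(n+m)}, M ≥ 1, and let A₁, A₀ be the policy matrices. Suppose P₀ ∈ ℝ^{(n+m)×(n+m)} is symmetric positive semidefinite and satisfies A₁ᵀ(A₀^{M−1})ᵀ P₀ A₀^{M−1} A₁ − P₀ + diag(Q, 0) + Kᵀ R K + Σ_{j=1}^{M−1} A₁ᵀ(A₀^{j−1})ᵀ diag(Q, R) A₀^{j−1} A₁ ⪯ 0. Consider the M-periodic time-triggered closed loop z(k+1) = A₁ z(k) if M divides k and z(k+1) = A₀ z(k) otherwise, with stage cost ℓ(k) = x(k)ᵀQx(k) + (Kz(k))ᵀR(Kz(k)) if M divides k and ℓ(k) = x(k)ᵀQx(k) + u(k)ᵀRu(k) otherwise, where z(k) = (x(k), u(k)). Then for every initial condition z(0) ∈ ℝ^{n+m},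 the series Σ_{k=0}^{∞} ℓ(k) converges and Σ_{k=0}^{∞} ℓ(k) ≤ z(0)ᵀ P₀ z(0). -/
open Matrix

lemma quad_conj {a b : Type*} [Fintype a] [Fintype b]
    (X : Matrix b a ℝ) (S : Matrix b b ℝ) (w : a → ℝ) :
    w ⬝ᵥ (Xᵀ * S * X).mulVec w = X.mulVec w ⬝ᵥ S.mulVec (X.mulVec w) := by
  rw [← mulVec_mulVec, ← mulVec_mulVec, dotProduct_mulVec, vecMul_transpose]

lemma quad_blocks {n m : ℕ} (Q : Matrix (Fin n) (Fin n) ℝ) (R : Matrix (Fin m) (Fin m) ℝ)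
    (w : Fin n ⊕ Fin m → ℝ) :
    w ⬝ᵥ (fromBlocks Q 0 0 R).mulVec w =
      xpart w ⬝ᵥ Q.mulVec (xpart w) + upart w ⬝ᵥ R.mulVec (upart w) := by
  simp [dotProduct, mulVec, Fintype.sum_sum_type, xpart, upart]

/-- Infinite-horizon cost bound for the `M`-periodic
time-triggered policy: if the symmetric positive semidefinite `P₀` satisfies
the Variant-1 matrix inequality, then along the `M`-periodic time-triggered
closed loop the series of stage costs converges and is bounded by
`z(0)ᵀ P₀ z(0)`. -/
theorem periodic_TTC_infinite_horizon_cost_bound {n m : ℕ}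
    (A : Matrix (Fin n) (Fin n) ℝ) (B : Matrix (Fin n) (Fin m) ℝ)
    (K : Matrix (Fin m) (Fin n ⊕ Fin m) ℝ)
    (M : ℕ) (hM : 1 ≤ M)
    (Q : Matrix (Fin n) (Fin n) ℝ) (R : Matrix (Fin m) (Fin m) ℝ)
    (hQ : Q.PosDef) (hR : R.PosDef)
    (P₀ : Matrix (Fin n ⊕ Fin m) (Fin n ⊕ Fin m) ℝ) (hP₀ : P₀.PosSemidef)
    -- Variant-1 matrix inequality
    (hMI : (-((A1mat A B K)ᵀ * ((A0mat A B) ^ (M - 1))ᵀ * P₀ * (A0mat A B) ^ (M - 1) *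
            A1mat A B K
          - P₀ + fromBlocks Q 0 0 0 + Kᵀ * R * K
          + ∑ j ∈ Finset.Icc 1 (M - 1),
              (A1mat A B K)ᵀ * ((A0mat A B) ^ (j - 1))ᵀ * fromBlocks Q 0 0 R *
                (A0mat A B) ^ (j - 1) * A1mat A B K)).PosSemidef)
    -- the M-periodic time-triggered closed loop
    (z : ℕ → Fin n ⊕ Fin m → ℝ)
    (hz : ∀ k : ℕ, z (k + 1) =
      (if M ∣ k then A1mat A B K else A0mat A B).mulVec (z k))
    -- the stage cost along the closed loop
    (ℓ : ℕ → ℝ)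
    (hℓ : ∀ k : ℕ, ℓ k =
      xpart (z k) ⬝ᵥ Q.mulVec (xpart (z k)) +
        (if M ∣ k then K.mulVec (z k) ⬝ᵥ R.mulVec (K.mulVec (z k))
         else upart (z k) ⬝ᵥ R.mulVec (upart (z k)))) :
    Summable ℓ ∧ ∑' k : ℕ, ℓ k ≤ z 0 ⬝ᵥ P₀.mulVec (z 0) := by
  have hzj : ∀ k, M ∣ k → ∀ j, j ≤ M - 1 →
      z (k + 1 + j) = ((A0mat A B) ^ j * A1mat A B K).mulVec (z k) := by
    intro k hk j
    induction j with
    | zero => intro _; simp [hz k, hk]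
    | succ j ih =>
      intro hj
      have hnd : ¬ M ∣ k + 1 + j := by
        intro h
        have h2 : M ∣ 1 + j := by
          rw [add_assoc] at h
          exact (Nat.dvd_add_right hk).1 h
        have := Nat.le_of_dvd (by omega) h2
        omega
      rw [← add_assoc, hz, if_neg hnd, ih (by omega), mulVec_mulVec, pow_succ', mul_assoc]
  have hnn : ∀ k, 0 ≤ ℓ k := by
    intro k
    rw [hℓ]
    have h1 : 0 ≤ xpart (z k) ⬝ᵥ Q.mulVec (xpart (z k)) := by
      simpa using hQ.posSemidef.dotProduct_mulVec_nonneg (xpart (z k))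
    have h2 : ∀ v, 0 ≤ v ⬝ᵥ R.mulVec v := fun v => by
      simpa using hR.posSemidef.dotProduct_mulVec_nonneg v
    split_ifs
    · exact add_nonneg h1 (h2 _)
    · exact add_nonneg h1 (h2 _)
  have hPnn : ∀ v, 0 ≤ v ⬝ᵥ P₀.mulVec v := fun v => by
    simpa using hP₀.dotProduct_mulVec_nonneg v
  have hstep : ∀ k, M ∣ k → (∑ i ∈ Finset.range M, ℓ (k + i)) +
      z (k + M) ⬝ᵥ P₀.mulVec (z (k + M)) ≤ z k ⬝ᵥ P₀.mulVec (z k) := by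
    intro k hk
    have h := hMI.dotProduct_mulVec_nonneg (z k)
    rw [star_trivial, neg_mulVec, dotProduct_neg, add_mulVec, add_mulVec, add_mulVec,
      sub_mulVec, dotProduct_add, dotProduct_add, dotProduct_add, dotProduct_sub,
      quad_conj, quad_blocks, sum_mulVec, dotProduct_sum] at h
    have e1 : z k ⬝ᵥ ((A1mat A B K)ᵀ * ((A0mat A B) ^ (M - 1))ᵀ * P₀ * (A0mat A B) ^ (M - 1) *
            A1mat A B K).mulVec (z k) = z (k + M) ⬝ᵥ P₀.mulVec (z (k + M)) := by
      have := hzj k hk (M - 1) le_rfl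
      rw [show k + 1 + (M - 1) = k + M by omega] at this
      rw [this, ← quad_conj, transpose_mul]
      simp only [mul_assoc]
    have e2 : ∑ j ∈ Finset.Icc 1 (M - 1), z k ⬝ᵥ ((A1mat A B K)ᵀ * ((A0mat A B) ^ (j - 1))ᵀ *
          fromBlocks Q 0 0 R * (A0mat A B) ^ (j - 1) * A1mat A B K).mulVec (z k)
        = ∑ i ∈ Finset.range (M - 1), ℓ (k + (i + 1)) := by
      rw [Finset.range_eq_Ico, Finset.sum_Ico_add' (fun i => ℓ (k + i)) 0 (M - 1) 1]
      refine Finset.sum_congr (by ext; simp) ?_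
      intro j hj
      have hj' := Finset.mem_Icc.1 hj
      have hnd : ¬ M ∣ k + j := by
        intro h
        have := Nat.le_of_dvd (by omega) ((Nat.dvd_add_right hk).1 h)
        omega
      have := hzj k hk (j - 1) (by omega)
      rw [show k + 1 + (j - 1) = k + j by omega] at this
      rw [hℓ, if_neg hnd, ← quad_blocks, this, ← quad_conj, transpose_mul]
      simp only [mul_assoc]
    have e3 : ∑ i ∈ Finset.range M, ℓ (k + i) =
        ∑ i ∈ Finset.range (M - 1), ℓ (k + (i + 1)) + ℓ k := by
      obtain ⟨M', rfl⟩ : ∃ M', M = M' + 1 := ⟨M - 1, by omega⟩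
      rw [Finset.sum_range_succ']
      simp
    have e4 := hℓ k
    rw [if_pos hk] at e4
    rw [e1, e2] at h
    simp only [zero_mulVec, dotProduct_zero] at h
    rw [e3, e4]
    linarith
  have hsum : ∀ N, (∑ i ∈ Finset.range (M * N), ℓ i) +
      z (M * N) ⬝ᵥ P₀.mulVec (z (M * N)) ≤ z 0 ⬝ᵥ P₀.mulVec (z 0) := by
    intro N
    induction N with
    | zero => simp
    | succ N ih =>
      rw [Nat.mul_succ, Finset.sum_range_add]
      have := hstep (M * N) (dvd_mul_right _ _)
      linarith
  have hbd : ∀ N, ∑ i ∈ Finset.range N, ℓ i ≤ z 0 ⬝ᵥ P₀.mulVec (z 0) := by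
    intro N
    have h1 : ∑ i ∈ Finset.range N, ℓ i ≤ ∑ i ∈ Finset.range (M * N), ℓ i :=
      Finset.sum_le_sum_of_subset_of_nonneg
        (Finset.range_subset_range.2 (Nat.le_mul_of_pos_left N hM)) (fun i _ _ => hnn i)
    have h2 := hsum N
    have h3 := hPnn (z (M * N))
    linarith
  exact ⟨summable_of_sum_range_le hnn hbd, Real.tsum_le_of_sum_range_le hnn hbd⟩
end

section
/- (Theorem 2: rollout ETC never performs worse than the optimal periodic time-triggered controller.) Consider the networked control system with token bucket traffic specification, unconstrained plant (𝕏 = ℝⁿ, 𝕌 = ℝ^m), and rollout ETC in Variant 1 with Z₀ = ℝ^{n+m}, prediction horizon N(k) = N̄ − (k mod M) with N̄ = rM for some r ∈ ℕ, r ≥ 1, terminal set S = ℝ^{n+m} × (ℤ ∩ [c−g, b]), and terminal cost V_f(ξ, k) = xᵀ P_x x (i.e., P₀ = diag(P_x, 0)) where P_x ∈ ℝ^{n×n} is symmetric positive semidefinite and the gain K = [K_x, 0] is such that P₀ = diag(P_x, 0) and K satisfy the Variant-1 matrix inequality A₁ᵀ(A₀^{M−1})ᵀ P₀ A₀^{M−1}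 A₁ − P₀ + diag(Q, 0) + Kᵀ R K + Σ_{j=1}^{M−1} A₁ᵀ(A₀^{j−1})ᵀ diag(Q, R) A₀^{j−1} A₁ ⪯ 0. If the initial bucket level satisfies c − g ≤ β(0) ≤ b, then along every closed-loop trajectory ξ(k+1) = f(ξ(k), π(k)) in which each π(k) is the first element of a minimizer of P(ξ(k), k), the infinite-horizon closed-loop cost satisfies Σ_{k=0}^{∞} ℓ(ξ(k), π(k)) ≤ x(0)ᵀ P_x x(0). -/
open Matrix

/-- Overall state of the networked control system: plant state `x`,
held input `u`, and integer bucket level `β`. -/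
abbrev NCSState (n m : ℕ) := (Fin n → ℝ) × (Fin m → ℝ) × ℤ

/-- Overall input: control update `v` and transmission decision `γ ∈ {0,1}`
(modelled as a `Bool`). -/
abbrev NCSInput (n m : ℕ) := (Fin m → ℝ) × Bool

/-- Overall dynamics
`f(ξ, π) = (Ax + Bγv + B(1-γ)u, γv + (1-γ)u, min (β + g - γc) b)`. -/
noncomputable def ncsDyn {n m : ℕ} (A : Matrix (Fin n) (Fin n) ℝ)
    (B : Matrix (Fin n) (Fin m) ℝ) (g c b : ℕ)
    (ξ : NCSState n m) (π : NCSInput n m) : NCSState n m :=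
  ⟨A.mulVec ξ.1 + B.mulVec (if π.2 then π.1 else ξ.2.1),
   if π.2 then π.1 else ξ.2.1,
   min (ξ.2.2 + (g : ℤ) - if π.2 then (c : ℤ) else 0) (b : ℤ)⟩

/-- The stacked vector `z = [x; u] ∈ ℝ^{n+m}`. -/
def vcat {n m : ℕ} (x : Fin n → ℝ) (u : Fin m → ℝ) : Fin n ⊕ Fin m → ℝ :=
  Sum.elim x u

/-- The trajectory of the overall system generated from initial state `ξ0`
by the input sequence `πs`. -/
noncomputable def ncsTraj {n m : ℕ} (A : Matrix (Fin n) (Fin n) ℝ)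
    (B : Matrix (Fin n) (Fin m) ℝ) (g c b : ℕ)
    (ξ0 : NCSState n m) (πs : ℕ → NCSInput n m) : ℕ → NCSState n m
  | 0 => ξ0
  | k + 1 => ncsDyn A B g c b (ncsTraj A B g c b ξ0 πs k) (πs k)

/-- Stage cost `ℓ(ξ, π) = xᵀQx + (1-γ)uᵀRu + γvᵀRv`. -/
noncomputable def stageCost {n m : ℕ} (Q : Matrix (Fin n) (Fin n) ℝ)
    (R : Matrix (Fin m) (Fin m) ℝ) (ξ : NCSState n m) (π : NCSInput n m) : ℝ :=
  ξ.1 ⬝ᵥ Q.mulVec ξ.1 +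
    (if π.2 then π.1 ⬝ᵥ R.mulVec π.1 else ξ.2.1 ⬝ᵥ R.mulVec ξ.2.1)

/-- Feasibility for the constrained OCP: state constraints
`ξ(i) ∈ Ξ = 𝕏 × 𝕌 × (ℤ ∩ [0, b])` and input constraints
`π(i) ∈ Π = 𝕌 × {0,1}` for `i = 0, …, N-1`, and terminal constraint
`ξ(N) ∈ Ξf`. -/
noncomputable def FeasOCP {n m : ℕ} (A : Matrix (Fin n) (Fin n) ℝ)
    (B : Matrix (Fin n) (Fin m) ℝ) (g c b : ℕ)
    (𝕏 : Set (Fin n → ℝ)) (𝕌 : Set (Fin m → ℝ))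
    (ξ0 : NCSState n m) (N : ℕ) (Ξf : Set (NCSState n m))
    (πs : ℕ → NCSInput n m) : Prop :=
  (∀ i < N, (ncsTraj A B g c b ξ0 πs i).1 ∈ 𝕏 ∧
      (ncsTraj A B g c b ξ0 πs i).2.1 ∈ 𝕌 ∧
      0 ≤ (ncsTraj A B g c b ξ0 πs i).2.2 ∧
      (ncsTraj A B g c b ξ0 πs i).2.2 ≤ (b : ℤ) ∧
      (πs i).1 ∈ 𝕌) ∧
  ncsTraj A B g c b ξ0 πs N ∈ Ξf

/-- Cost of the OCP with horizon `N` and terminal cost `Vf`: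
`Σ_{i<N} ℓ(ξ(i), π(i)) + Vf(ξ(N))`. -/
noncomputable def costGen {n m : ℕ} (A : Matrix (Fin n) (Fin n) ℝ)
    (B : Matrix (Fin n) (Fin m) ℝ) (g c b : ℕ)
    (Q : Matrix (Fin n) (Fin n) ℝ) (R : Matrix (Fin m) (Fin m) ℝ)
    (Vf : NCSState n m → ℝ)
    (ξ0 : NCSState n m) (N : ℕ) (πs : ℕ → NCSInput n m) : ℝ :=
  ∑ i ∈ Finset.range N, stageCost Q R (ncsTraj A B g c b ξ0 πs i) (πs i) +
    Vf (ncsTraj A B g c b ξ0 πs N)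

/-- Feasibility for the unconstrained-plant OCP (Variant 1 with
`Z₀ = ℝ^{n+m}`): bucket levels stay in `ℤ ∩ [0, b]` and the terminal bucket
level lies in `ℤ ∩ [c-g, b]`. -/
noncomputable def FeasU {n m : ℕ} (A : Matrix (Fin n) (Fin n) ℝ)
    (B : Matrix (Fin n) (Fin m) ℝ) (g c b : ℕ)
    (ξ0 : NCSState n m) (N : ℕ) (πs : ℕ → NCSInput n m) : Prop :=
  (∀ i ≤ N, 0 ≤ (ncsTraj A B g c b ξ0 πs i).2.2 ∧
      (ncsTraj A B g c b ξ0 πs i).2.2 ≤ (b : ℤ)) ∧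
  (c : ℤ) - (g : ℤ) ≤ (ncsTraj A B g c b ξ0 πs N).2.2 ∧
  (ncsTraj A B g c b ξ0 πs N).2.2 ≤ (b : ℤ)

section helpers

variable {n m : ℕ} (A : Matrix (Fin n) (Fin n) ℝ) (B : Matrix (Fin n) (Fin m) ℝ) (g c b : ℕ)

lemma traj_add (ξ : NCSState n m) (πs : ℕ → NCSInput n m) (N i : ℕ) :
    ncsTraj A B g c b ξ πs (N + i) =
      ncsTraj A B g c b (ncsTraj A B g c b ξ πs N) (fun j => πs (N + j)) i := by
  induction i with
  | zero => rfl
  | succ i ih =>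
    rw [← add_assoc]
    simp only [ncsTraj, ih]

lemma traj_congr (ξ : NCSState n m) (πs πs' : ℕ → NCSInput n m) (N : ℕ)
    (h : ∀ i < N, πs' i = πs i) (i : ℕ) (hi : i ≤ N) :
    ncsTraj A B g c b ξ πs' i = ncsTraj A B g c b ξ πs i := by
  induction i with
  | zero => rfl
  | succ i ih =>
    simp only [ncsTraj]
    rw [ih (by omega), h i (by omega)]

lemma cost_add (Q : Matrix (Fin n) (Fin n) ℝ) (R : Matrix (Fin m) (Fin m) ℝ)
    (Vf : NCSState n m → ℝ) (ξ : NCSState n m) (πs : ℕ → NCSInput n m) (N L : ℕ) :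
    costGen A B g c b Q R Vf ξ (N + L) πs =
      ∑ i ∈ Finset.range N, stageCost Q R (ncsTraj A B g c b ξ πs i) (πs i) +
      costGen A B g c b Q R Vf (ncsTraj A B g c b ξ πs N) L (fun j => πs (N + j)) := by
  unfold costGen
  rw [Finset.sum_range_add, traj_add, add_assoc]
  congr 2
  exact Finset.sum_congr rfl fun i _ => by rw [traj_add]

lemma feas_shift (ξ : NCSState n m) (πs : ℕ → NCSInput n m) (N : ℕ)
    (h : FeasU A B g c b ξ (1 + N) πs) :
    FeasU A B g c b (ncsTraj A B g c b ξ πs 1) N (fun j => πs (1 + j)) := by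
  obtain ⟨h1, h2⟩ := h
  refine ⟨fun i hi => ?_, ?_⟩
  · rw [← traj_add]; exact h1 _ (by omega)
  · rw [← traj_add]; exact h2

/-- Periodic base policy over one period. -/
def basePol (v : Fin m → ℝ) : ℕ → NCSInput n m
  | 0 => (v, true)
  | _ + 1 => (0, false)

lemma base_bucket (ξ : NCSState n m) (v : Fin m → ℝ) (i : ℕ) (hgc : g ≤ c) (hcb : c ≤ b)
    (h : ξ.2.2 ≤ (b : ℤ)) :
    (ncsTraj A B g c b ξ (basePol (n := n) v) (i + 1)).2.2 =
      min (ξ.2.2 + ((i + 1 : ℕ) : ℤ) * g - c) b := by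
  induction i with
  | zero => simp [ncsTraj, ncsDyn, basePol]
  | succ i ih =>
    rw [ncsTraj]
    simp only [ncsDyn, ih, basePol]
    push_cast
    have : ((i : ℤ) + 1 + 1) * g = (i + 1) * g + g := by ring
    rw [this]
    omega

lemma base_feas (ξ : NCSState n m) (v : Fin m → ℝ) (M : ℕ) (hgc : g ≤ c) (hcb : c ≤ b)
    (hM1 : 1 ≤ M) (hM : c ≤ M * g)
    (hl : (c : ℤ) - g ≤ ξ.2.2) (hu : ξ.2.2 ≤ (b : ℤ)) :
    FeasU A B g c b ξ M (basePol (n := n) v) := by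
  have key : ∀ i, 0 ≤ (ncsTraj A B g c b ξ (basePol (n := n) v) i).2.2 ∧
      (ncsTraj A B g c b ξ (basePol (n := n) v) i).2.2 ≤ (b : ℤ) := by
    intro i
    cases i with
    | zero => simp only [ncsTraj]; omega
    | succ i =>
      rw [base_bucket A B g c b ξ v i hgc hcb hu]
      have : (((i + 1 : ℕ)) : ℤ) * g = i * g + g := by push_cast; ring
      have h2 : (0 : ℤ) ≤ (i : ℤ) * g := by positivity
      rw [this]
      omega
  refine ⟨fun i _ => key i, ?_, (key M).2⟩
  obtain ⟨k, rfl⟩ : ∃ k, M = k + 1 := ⟨M - 1, by omega⟩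
  rw [base_bucket A B g c b ξ v k hgc hcb hu]
  have : (c : ℤ) ≤ ((k + 1 : ℕ) : ℤ) * g := by exact_mod_cast hM
  omega

lemma A0_vcat (x : Fin n → ℝ) (u : Fin m → ℝ) :
    A0mat A B *ᵥ vcat x u = vcat (A *ᵥ x + B *ᵥ u) u := by
  simp [A0mat, vcat, fromBlocks_mulVec]

lemma A1_vcat (K : Matrix (Fin m) (Fin n ⊕ Fin m) ℝ) (x : Fin n → ℝ) (u : Fin m → ℝ) :
    A1mat A B K *ᵥ vcat x u =
      vcat (A *ᵥ x + B *ᵥ (K *ᵥ vcat x u)) (K *ᵥ vcat x u) := by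
  rw [A1mat, add_mulVec, ← mulVec_mulVec, fromRows_mulVec]
  ext i
  cases i <;> simp [vcat, fromBlocks_mulVec]

lemma quad_vcat (Q : Matrix (Fin n) (Fin n) ℝ) (R : Matrix (Fin m) (Fin m) ℝ)
    (x : Fin n → ℝ) (u : Fin m → ℝ) :
    vcat x u ⬝ᵥ (fromBlocks Q 0 0 R *ᵥ vcat x u) = x ⬝ᵥ Q *ᵥ x + u ⬝ᵥ R *ᵥ u := by
  simp [vcat, fromBlocks_mulVec]

lemma quad_conj_s14 {p q : Type*} [Fintype p] [Fintype q] (T : Matrix p q ℝ) (S : Matrix p p ℝ)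
    (z : q → ℝ) :
    z ⬝ᵥ ((Tᵀ * S * T) *ᵥ z) = (T *ᵥ z) ⬝ᵥ (S *ᵥ (T *ᵥ z)) := by
  rw [Matrix.mul_assoc, ← mulVec_mulVec, ← mulVec_mulVec, dotProduct_mulVec, vecMul_transpose]

lemma base_z (K : Matrix (Fin m) (Fin n ⊕ Fin m) ℝ) (ξ : NCSState n m) (i : ℕ) :
    vcat (ncsTraj A B g c b ξ (basePol (n := n) (K *ᵥ vcat ξ.1 ξ.2.1)) (i + 1)).1
      (ncsTraj A B g c b ξ (basePol (n := n) (K *ᵥ vcat ξ.1 ξ.2.1)) (i + 1)).2.1 =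
    (A0mat A B ^ i * A1mat A B K) *ᵥ vcat ξ.1 ξ.2.1 := by
  induction i with
  | zero =>
    rw [pow_zero, one_mul, A1_vcat]
    simp [ncsTraj, ncsDyn, basePol]
  | succ i ih =>
    rw [pow_succ', mul_assoc, ← mulVec_mulVec, ← ih, A0_vcat]
    rw [ncsTraj]
    simp [ncsDyn, basePol]

lemma base_cost (Q : Matrix (Fin n) (Fin n) ℝ) (R : Matrix (Fin m) (Fin m) ℝ)
    (K : Matrix (Fin m) (Fin n ⊕ Fin m) ℝ)
    (P₀ : Matrix (Fin n ⊕ Fin m) (Fin n ⊕ Fin m) ℝ) (M : ℕ) (hM1 : 1 ≤ M)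
    (hMI : (-((A1mat A B K)ᵀ * ((A0mat A B) ^ (M - 1))ᵀ * P₀ * (A0mat A B) ^ (M - 1) *
            A1mat A B K
          - P₀ + fromBlocks Q 0 0 0 + Kᵀ * R * K
          + ∑ j ∈ Finset.Icc 1 (M - 1),
              (A1mat A B K)ᵀ * ((A0mat A B) ^ (j - 1))ᵀ * fromBlocks Q 0 0 R *
                (A0mat A B) ^ (j - 1) * A1mat A B K)).PosSemidef)
    (ξ : NCSState n m) :
    costGen A B g c b Q R (fun ξ => vcat ξ.1 ξ.2.1 ⬝ᵥ P₀.mulVec (vcat ξ.1 ξ.2.1)) ξ M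
      (basePol (n := n) (K *ᵥ vcat ξ.1 ξ.2.1)) ≤
      vcat ξ.1 ξ.2.1 ⬝ᵥ P₀.mulVec (vcat ξ.1 ξ.2.1) := by
  obtain ⟨k, rfl⟩ : ∃ k, M = k + 1 := ⟨M - 1, by omega⟩
  have h := hMI.dotProduct_mulVec_nonneg (vcat ξ.1 ξ.2.1)
  have e : ∀ (i : ℕ) (S : Matrix (Fin n ⊕ Fin m) (Fin n ⊕ Fin m) ℝ),
      (A1mat A B K)ᵀ * ((A0mat A B) ^ i)ᵀ * S * (A0mat A B) ^ i * A1mat A B K =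
      (A0mat A B ^ i * A1mat A B K)ᵀ * S * (A0mat A B ^ i * A1mat A B K) := by
    intro i S
    rw [transpose_mul]
    simp only [mul_assoc]
  have e2 : Finset.Icc 1 k = Finset.Ico 1 (k + 1) := by ext; simp <;> omega
  simp only [e, star_trivial, Nat.add_sub_cancel, e2, Finset.sum_Ico_eq_sum_range,
    Nat.add_sub_cancel_left] at h
  rw [neg_mulVec, dotProduct_neg, add_mulVec, add_mulVec, add_mulVec, sub_mulVec,
    dotProduct_add, dotProduct_add, dotProduct_add, dotProduct_sub, sum_mulVec,
    dotProduct_sum] at h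
  simp only [quad_conj_s14, quad_vcat, zero_mulVec, dotProduct_zero, add_zero] at h
  unfold costGen
  rw [Finset.sum_range_succ']
  have hs : ∀ i, stageCost Q R
      (ncsTraj A B g c b ξ (basePol (n := n) (K *ᵥ vcat ξ.1 ξ.2.1)) (i + 1))
      (basePol (n := n) (K *ᵥ vcat ξ.1 ξ.2.1) (i + 1)) =
      ((A0mat A B ^ i * A1mat A B K) *ᵥ vcat ξ.1 ξ.2.1) ⬝ᵥ (fromBlocks Q 0 0 R *ᵥ
        ((A0mat A B ^ i * A1mat A B K) *ᵥ vcat ξ.1 ξ.2.1)) := by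
    intro i
    rw [← base_z A B g c b, quad_vcat]
    simp [stageCost, basePol]
  have h0 : stageCost Q R (ncsTraj A B g c b ξ (basePol (n := n) (K *ᵥ vcat ξ.1 ξ.2.1)) 0)
      (basePol (n := n) (K *ᵥ vcat ξ.1 ξ.2.1) 0) =
      ξ.1 ⬝ᵥ Q *ᵥ ξ.1 + (K *ᵥ vcat ξ.1 ξ.2.1) ⬝ᵥ (R *ᵥ (K *ᵥ vcat ξ.1 ξ.2.1)) := by
    simp [stageCost, basePol, ncsTraj]
  simp only [hs, h0, base_z]
  linarith

lemma extend (Q : Matrix (Fin n) (Fin n) ℝ) (R : Matrix (Fin m) (Fin m) ℝ)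
    (K : Matrix (Fin m) (Fin n ⊕ Fin m) ℝ)
    (P₀ : Matrix (Fin n ⊕ Fin m) (Fin n ⊕ Fin m) ℝ) (M : ℕ) (hM1 : 1 ≤ M)
    (hgc : g ≤ c) (hcb : c ≤ b) (hM : c ≤ M * g)
    (hMI : (-((A1mat A B K)ᵀ * ((A0mat A B) ^ (M - 1))ᵀ * P₀ * (A0mat A B) ^ (M - 1) *
            A1mat A B K
          - P₀ + fromBlocks Q 0 0 0 + Kᵀ * R * K
          + ∑ j ∈ Finset.Icc 1 (M - 1),
              (A1mat A B K)ᵀ * ((A0mat A B) ^ (j - 1))ᵀ * fromBlocks Q 0 0 R *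
                (A0mat A B) ^ (j - 1) * A1mat A B K)).PosSemidef)
    (ξ : NCSState n m) (N : ℕ) (πs : ℕ → NCSInput n m) (hf : FeasU A B g c b ξ N πs) :
    ∃ πs', FeasU A B g c b ξ (N + M) πs' ∧
      costGen A B g c b Q R (fun ξ => vcat ξ.1 ξ.2.1 ⬝ᵥ P₀.mulVec (vcat ξ.1 ξ.2.1)) ξ (N + M) πs'
      ≤ costGen A B g c b Q R (fun ξ => vcat ξ.1 ξ.2.1 ⬝ᵥ P₀.mulVec (vcat ξ.1 ξ.2.1)) ξ N πs := by
  obtain ⟨η, hη⟩ : ∃ η, η = ncsTraj A B g c b ξ πs N := ⟨_, rfl⟩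
  let p : ℕ → NCSInput n m := basePol (n := n) (K *ᵥ vcat η.1 η.2.1)
  let q : ℕ → NCSInput n m := fun i => if i < N then πs i else p (i - N)
  have hq1 : ∀ i < N, q i = πs i := fun i hi => by simp [q, hi]
  have hq2 : (fun j => q (N + j)) = p := by funext j; simp [q]
  have ht := traj_congr A B g c b ξ πs q N hq1
  have ht2 : ∀ i, ncsTraj A B g c b ξ q (N + i) = ncsTraj A B g c b η p i := by
    intro i; rw [traj_add, hq2, ht N le_rfl, hη]
  have hbf : FeasU A B g c b η M p :=
    base_feas A B g c b η _ M hgc hcb hM1 hM (hη ▸ hf.2.1) (hη ▸ hf.2.2)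
  refine ⟨q, ⟨fun i hi => ?_, ?_⟩, ?_⟩
  · by_cases h : i ≤ N
    · rw [ht i h]; exact hf.1 i h
    · obtain ⟨j, rfl⟩ : ∃ j, i = N + j := ⟨i - N, by omega⟩
      rw [ht2]; exact hbf.1 j (by omega)
  · rw [ht2]; exact hbf.2
  · rw [cost_add, hq2, ht N le_rfl, ← hη]
    have h1 := base_cost A B g c b Q R K P₀ M hM1 hMI η
    have h2 : ∑ i ∈ Finset.range N, stageCost Q R (ncsTraj A B g c b ξ q i) (q i) =
        ∑ i ∈ Finset.range N, stageCost Q R (ncsTraj A B g c b ξ πs i) (πs i) := by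
      refine Finset.sum_congr rfl fun i hi => ?_
      have := Finset.mem_range.1 hi
      rw [ht i (by omega), hq1 i this]
    rw [h2]
    conv_rhs => rw [costGen, ← hη]
    exact add_le_add le_rfl h1

lemma stage_nonneg (Q : Matrix (Fin n) (Fin n) ℝ) (R : Matrix (Fin m) (Fin m) ℝ)
    (hQ : Q.PosDef) (hR : R.PosDef) (ξ : NCSState n m) (π : NCSInput n m) :
    0 ≤ stageCost Q R ξ π := by
  have h1 := hQ.posSemidef.dotProduct_mulVec_nonneg ξ.1
  have h2 := hR.posSemidef.dotProduct_mulVec_nonneg ξ.2.1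
  have h3 := hR.posSemidef.dotProduct_mulVec_nonneg π.1
  simp only [star_trivial] at h1 h2 h3
  unfold stageCost
  split_ifs <;> linarith

end helpers

/-- **Theorem 2.** Rollout ETC never performs worse than the
optimal periodic time-triggered controller: for the unconstrained plant,
Variant 1 with `Z₀ = ℝ^{n+m}`, horizon `N̄ = rM`, terminal cost `xᵀ P_x x`
(i.e. `P₀ = diag(P_x, 0)`) and gain `K = [K_x, 0]` satisfying the Variant-1
matrix inequality, if `c - g ≤ β(0) ≤ b`, then the infinite-horizon
closed-loop cost of rollout ETC is at most `x(0)ᵀ P_x x(0)`. -/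
theorem rolloutETC_performance_bound {n m : ℕ}
    (A : Matrix (Fin n) (Fin n) ℝ) (B : Matrix (Fin n) (Fin m) ℝ)
    (g c b M : ℕ) (hg : 1 ≤ g) (hgc : g ≤ c) (hcb : c ≤ b)
    (hM : M = ⌈(c : ℚ) / (g : ℚ)⌉₊)
    (Q : Matrix (Fin n) (Fin n) ℝ) (R : Matrix (Fin m) (Fin m) ℝ)
    (hQ : Q.PosDef) (hR : R.PosDef)
    (Px : Matrix (Fin n) (Fin n) ℝ) (hPx : Px.PosSemidef)
    (Kx : Matrix (Fin m) (Fin n) ℝ)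
    -- `K = [K_x, 0]` and `P₀ = diag(P_x, 0)`
    (K : Matrix (Fin m) (Fin n ⊕ Fin m) ℝ)
    (hK : K = fromCols Kx (0 : Matrix (Fin m) (Fin m) ℝ))
    (P₀ : Matrix (Fin n ⊕ Fin m) (Fin n ⊕ Fin m) ℝ)
    (hP₀ : P₀ = fromBlocks Px 0 0 0)
    -- Variant-1 matrix inequality
    (hMI : (-((A1mat A B K)ᵀ * ((A0mat A B) ^ (M - 1))ᵀ * P₀ * (A0mat A B) ^ (M - 1) *
            A1mat A B K
          - P₀ + fromBlocks Q 0 0 0 + Kᵀ * R * K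
          + ∑ j ∈ Finset.Icc 1 (M - 1),
              (A1mat A B K)ᵀ * ((A0mat A B) ^ (j - 1))ᵀ * fromBlocks Q 0 0 R *
                (A0mat A B) ^ (j - 1) * A1mat A B K)).PosSemidef)
    -- horizon `N̄ = rM`, cyclic prediction horizon `N(k) = N̄ - (k mod M)`
    (r Nb : ℕ) (hr : 1 ≤ r) (hNb : Nb = r * M)
    -- closed loop generated by Algorithm 1
    (ξcl : ℕ → NCSState n m) (πcl : ℕ → NCSInput n m)
    (hcl : ∀ k : ℕ, ξcl (k + 1) = ncsDyn A B g c b (ξcl k) (πcl k))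
    -- whenever the OCP at time `k` is feasible, `π(k)` is the first element
    -- of a minimizer of the OCP at time `k`
    (hopt : ∀ k : ℕ,
      (∃ πs : ℕ → NCSInput n m, FeasU A B g c b (ξcl k) (Nb - k % M) πs) →
      ∃ πs : ℕ → NCSInput n m,
        FeasU A B g c b (ξcl k) (Nb - k % M) πs ∧
        (∀ πs' : ℕ → NCSInput n m, FeasU A B g c b (ξcl k) (Nb - k % M) πs' →
          costGen A B g c b Q R
              (fun ξ => vcat ξ.1 ξ.2.1 ⬝ᵥ P₀.mulVec (vcat ξ.1 ξ.2.1))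
              (ξcl k) (Nb - k % M) πs ≤
            costGen A B g c b Q R
              (fun ξ => vcat ξ.1 ξ.2.1 ⬝ᵥ P₀.mulVec (vcat ξ.1 ξ.2.1))
              (ξcl k) (Nb - k % M) πs') ∧
        πcl k = πs 0)
    -- initial bucket level `c - g ≤ β(0) ≤ b`
    (hβ0l : (c : ℤ) - (g : ℤ) ≤ (ξcl 0).2.2) (hβ0u : (ξcl 0).2.2 ≤ (b : ℤ)) :
    Summable (fun k : ℕ => stageCost Q R (ξcl k) (πcl k)) ∧
    ∑' k : ℕ, stageCost Q R (ξcl k) (πcl k) ≤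
      (ξcl 0).1 ⬝ᵥ Px.mulVec (ξcl 0).1 := by
  have hg0 : (0 : ℚ) < g := by exact_mod_cast hg
  have hMc : c ≤ M * g := by
    have h := Nat.le_ceil ((c : ℚ) / (g : ℚ))
    rw [← hM, div_le_iff₀ hg0] at h
    exact_mod_cast h
  have hM1 : 1 ≤ M := by
    rcases Nat.eq_zero_or_pos M with h | h
    · subst h; omega
    · exact h
  have ext := extend A B g c b Q R K P₀ M hM1 hgc hcb hMc hMI
  set Vf : NCSState n m → ℝ :=
    fun ξ => vcat ξ.1 ξ.2.1 ⬝ᵥ P₀.mulVec (vcat ξ.1 ξ.2.1) with hVf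
  have hPn : ∀ ξ, Vf ξ = ξ.1 ⬝ᵥ Px.mulVec ξ.1 := by
    intro ξ
    simp only [hVf, hP₀, quad_vcat]
    simp
  have hV0 : ∀ ξ, 0 ≤ Vf ξ := by
    intro ξ
    have := hPx.dotProduct_mulVec_nonneg ξ.1
    rw [hPn]
    simpa only [star_trivial] using this
  have hst := stage_nonneg Q R hQ hR
  -- initial candidate
  have init : ∀ s : ℕ, ∃ πs, FeasU A B g c b (ξcl 0) (s * M) πs ∧
      costGen A B g c b Q R Vf (ξcl 0) (s * M) πs ≤ Vf (ξcl 0) := by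
    intro s
    induction s with
    | zero =>
      refine ⟨fun _ => (0, false), ⟨fun i hi => ?_, ?_⟩, ?_⟩
      · obtain rfl : i = 0 := by omega
        simp only [ncsTraj]; omega
      · simp only [Nat.zero_mul, ncsTraj]; exact ⟨hβ0l, hβ0u⟩
      · simp [costGen, ncsTraj]
    | succ s ih =>
      obtain ⟨πs, h1, h2⟩ := ih
      obtain ⟨q, h3, h4⟩ := ext _ _ _ h1
      rw [Nat.succ_mul]
      exact ⟨q, h3, h4.trans h2⟩
  -- candidate at every time
  have main : ∀ k : ℕ, ∃ πs, FeasU A B g c b (ξcl k) (Nb - k % M) πs ∧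
      ∑ i ∈ Finset.range k, stageCost Q R (ξcl i) (πcl i) +
        costGen A B g c b Q R Vf (ξcl k) (Nb - k % M) πs ≤ Vf (ξcl 0) := by
    intro k
    induction k with
    | zero =>
      obtain ⟨q, h1, h2⟩ := init r
      refine ⟨q, ?_, ?_⟩
      · simpa [hNb] using h1
      · simpa [hNb] using h2
    | succ k ih =>
      obtain ⟨q, h1, h2⟩ := ih
      obtain ⟨πs, hf, hmin, h0⟩ := hopt k ⟨q, h1⟩
      have hle := hmin q h1
      have hkM : k % M < M := Nat.mod_lt _ (by omega)
      have hNM : M ≤ Nb := by rw [hNb]; exact Nat.le_mul_of_pos_left M hr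
      obtain ⟨L, hL⟩ : ∃ L, Nb - k % M = 1 + L := ⟨Nb - k % M - 1, by omega⟩
      rw [hL] at hf
      rw [hL] at hle h2
      have hstate : ncsTraj A B g c b (ξcl k) πs 1 = ξcl (k + 1) := by
        rw [hcl, h0]; rfl
      have hf' := feas_shift A B g c b _ _ _ hf
      have hc' := cost_add A B g c b Q R Vf (ξcl k) πs 1 L
      rw [hstate] at hf' hc'
      have hz : ∑ i ∈ Finset.range 1, stageCost Q R (ncsTraj A B g c b (ξcl k) πs i) (πs i)
          = stageCost Q R (ξcl k) (πcl k) := by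
        simp [ncsTraj, h0]
      rw [hz] at hc'
      rw [Finset.sum_range_succ]
      by_cases hlast : k % M + 1 = M
      · have hmod : (k + 1) % M = 0 := by
          rw [← Nat.mod_add_mod, hlast, Nat.mod_self]
        have hN' : Nb - (k + 1) % M = L + M := by omega
        obtain ⟨q', h3, h4⟩ := ext _ _ _ hf'
        rw [hN']
        exact ⟨q', h3, by linarith⟩
      · have hmod : (k + 1) % M = k % M + 1 := by
          rw [Nat.add_mod, Nat.mod_eq_of_lt (show 1 < M by omega), Nat.mod_eq_of_lt (by omega)]
        have hN' : Nb - (k + 1) % M = L := by omega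
        rw [hN']
        exact ⟨_, hf', by linarith⟩
  have bound : ∀ k, ∑ i ∈ Finset.range k, stageCost Q R (ξcl i) (πcl i) ≤
      (ξcl 0).1 ⬝ᵥ Px.mulVec (ξcl 0).1 := by
    intro k
    obtain ⟨q, _, h⟩ := main k
    have hcn : 0 ≤ costGen A B g c b Q R Vf (ξcl k) (Nb - k % M) q :=
      add_nonneg (Finset.sum_nonneg fun i _ => hst _ _) (hV0 _)
    rw [← hPn]
    linarith
  exact ⟨summable_of_sum_range_le (fun _ => hst _ _) bound,
    Real.tsum_le_of_sum_range_le (fun _ => hst _ _) bound⟩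
end
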